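/- Let m ≥ 1 and let (G(h))_{h ∈ ℝ_{≥0}^m} be a centered Gaussian process with continuous sample paths such that E[G(h)·G(h')] = ∏_{k=1}^m (h_k ∧ h'_k + 1) for all h, h' ∈ ℝ_{≥0}^m. Then there exists a constant C_m > 0, depending only on m, such that for every u ≥ 1, P( sup_{h ∈ ℝ_{≥0}^m} |G(h)| / ∏_{k=1}^m (h_k + 1) > u ) ≤ C_m · exp(−u²/C_m). -/

import Mathlib

open MeasureTheory ProbabilityTheory

/-- A family `G` of real random variables is a centered Gaussian process if every finite
linear combination has a centered Gaussian distribution. -/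
def IsCenteredGaussianProcess {Ω T : Type*} [MeasurableSpace Ω] (P : Measure Ω)
    (G : T → Ω → ℝ) : Prop :=
  (∀ t, Measurable (G t)) ∧
    ∀ (n : ℕ) (t : Fin n → T) (c : Fin n → ℝ),
      ∃ v : NNReal,
        Measure.map (fun ω => ∑ i : Fin n, c i * G (t i) ω) P = gaussianReal 0 v

lemma aux_tail {Ω : Type*} [MeasurableSpace Ω] (P : Measure Ω) [IsProbabilityMeasure P]
    (Y : Ω → ℝ) (hYm : Measurable Y) (v : NNReal) (hY : Measure.map Y P = gaussianReal 0 v)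
    (w : ℝ) (hw : ∫ ω, Y ω * Y ω ∂P ≤ w) (a : ℝ) (ha : 0 ≤ a) :
    P {ω | a < |Y ω|} ≤ ENNReal.ofReal (2 * Real.exp (-a ^ 2 / (2 * w))) := by
  have hv : ∫ ω, Y ω * Y ω ∂P = v := by
    have h1 : ∫ x, x * x ∂(Measure.map Y P) = ∫ ω, Y ω * Y ω ∂P :=
      integral_map hYm.aemeasurable (by fun_prop)
    rw [← h1, hY]
    have h2 := variance_fun_id_gaussianReal (μ := 0) (v := v)
    rw [variance_of_integral_eq_zero (by fun_prop) integral_id_gaussianReal] at h2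
    rw [← h2]
    congr 1
    ext x
    ring
  have hvw : (v : ℝ) ≤ w := hv ▸ hw
  have hw0 : 0 ≤ w := v.2.trans hvw
  have hs : HasSubgaussianMGF Y ⟨w, hw0⟩ P := by
    refine ⟨fun t => ?_, fun t => ?_⟩
    · have := integrable_exp_mul_gaussianReal (μ := 0) (v := v) t
      rw [← hY] at this
      exact this.comp_measurable hYm
    · rw [mgf_gaussianReal hY]
      apply Real.exp_le_exp.2
      change 0 * t + (v : ℝ) * t ^ 2 / 2 ≤ w * t ^ 2 / 2
      nlinarith [mul_le_mul_of_nonneg_right hvw (sq_nonneg t)]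
  have h1 := hs.measure_ge_le ha
  have h2 := hs.neg.measure_ge_le ha
  change _ ≤ Real.exp (-a ^ 2 / (2 * w)) at h1
  change _ ≤ Real.exp (-a ^ 2 / (2 * w)) at h2
  have hsub : {ω | a < |Y ω|} ⊆ {ω | a ≤ Y ω} ∪ {ω | a ≤ (-Y) ω} := by
    intro ω hω
    have hω2 : a < |Y ω| := hω
    rcases lt_abs.1 hω2 with h | h
    · exact Or.inl h.le
    · exact Or.inr h.le
  rw [← ofReal_measureReal]
  apply ENNReal.ofReal_le_ofReal
  calc _ ≤ P.real ({ω | a ≤ Y ω} ∪ {ω | a ≤ (-Y) ω}) := measureReal_mono hsub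
    _ ≤ _ := measureReal_union_le _ _
    _ ≤ _ := by linarith

lemma aux_prod {ι : Type*} (F : Finset ι) (s t : ι → ℝ) (d : ℝ) (hs : ∀ i, 0 ≤ s i)
    (hst : ∀ i, s i ≤ t i) (ht : ∀ i, t i ≤ 1) (hd : ∀ i, t i - s i ≤ d) :
    ∏ i ∈ F, t i - ∏ i ∈ F, s i ≤ F.card * d := by
  classical
  induction F using Finset.induction_on with
  | empty => simp
  | insert i F hi ih =>
    rw [Finset.prod_insert hi, Finset.prod_insert hi, Finset.card_insert_of_notMem hi]
    push_cast
    have h1 : ∏ i ∈ F, t i ≤ 1 := Finset.prod_le_one (fun i _ => (hs i).trans (hst i)) fun i _ => ht i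
    have h0 : 0 ≤ ∏ i ∈ F, s i := Finset.prod_nonneg fun i _ => hs i
    have h01 : ∏ i ∈ F, s i ≤ ∏ i ∈ F, t i := Finset.prod_le_prod (fun i _ => hs i) fun i _ => hst i
    have h2 : t i * (∏ i ∈ F, t i) - s i * ∏ i ∈ F, s i
      = (t i - s i) * (∏ i ∈ F, t i) + s i * (∏ i ∈ F, t i - ∏ i ∈ F, s i) := by ring
    rw [h2]
    have h3 : (t i - s i) * (∏ i ∈ F, t i) ≤ d := by
      nlinarith [hst i, hd i]
    have h4 : s i * (∏ i ∈ F, t i - ∏ i ∈ F, s i) ≤ ∏ i ∈ F, t i - ∏ i ∈ F, s i := by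
      nlinarith [hs i, hst i, ht i]
    linarith

/-- inverse time change -/
noncomputable def auxH {m : ℕ} (s : Fin m → ℝ) : Fin m → NNReal := fun k => Real.toNNReal ((s k)⁻¹ - 1)

noncomputable def auxX {m : ℕ} {Ω : Type} (G : (Fin m → NNReal) → Ω → ℝ) (s : Fin m → ℝ) (ω : Ω) : ℝ :=
  (∏ k, s k) * G (auxH s) ω

noncomputable def auxp {m : ℕ} (n : ℕ) (N : Fin m → ℕ) : Fin m → ℝ := fun k => (N k : ℝ) / 2 ^ n

noncomputable def auxD {m : ℕ} {Ω : Type} (G : (Fin m → NNReal) → Ω → ℝ) :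
    (n : ℕ) → (N : Fin m → ℕ) → Ω → ℝ
  | 0, N => fun ω => auxX G (auxp 0 N) ω
  | n + 1, N => fun ω => auxX G (auxp (n + 1) N) ω - auxX G (auxp n (fun k => (N k + 1) / 2)) ω

lemma auxX_cov {m : ℕ} {Ω : Type} [MeasurableSpace Ω] (P : Measure Ω)
    (G : (Fin m → NNReal) → Ω → ℝ)
    (hcov : ∀ h h' : Fin m → NNReal,
          ∫ ω, G h ω * G h' ω ∂P = ∏ k : Fin m, (((min (h k) (h' k) : NNReal) : ℝ) + 1))
    (s t : Fin m → ℝ) (hs : ∀ k, 0 < s k) (hst : ∀ k, s k ≤ t k) (ht : ∀ k, t k ≤ 1) :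
    ∫ ω, auxX G s ω * auxX G t ω ∂P = ∏ k, s k := by
  have h1 : ∀ ω, auxX G s ω * auxX G t ω
      = ((∏ k, s k) * ∏ k, t k) * (G (auxH s) ω * G (auxH t) ω) := by
    intro ω; unfold auxX; ring
  simp_rw [h1]
  rw [integral_const_mul, hcov, ← Finset.prod_mul_distrib, ← Finset.prod_mul_distrib]
  refine Finset.prod_congr rfl fun k _ => ?_
  have htk : 0 < t k := (hs k).trans_le (hst k)
  have h2 : (t k)⁻¹ ≤ (s k)⁻¹ := inv_anti₀ (hs k) (hst k)
  have h3 : 1 ≤ (t k)⁻¹ := (one_le_inv₀ htk).2 (ht k)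
  have h4 : auxH t k ≤ auxH s k := Real.toNNReal_le_toNNReal (by linarith)
  rw [min_eq_right h4]
  unfold auxH
  rw [Real.coe_toNNReal _ (by linarith)]
  field_simp
  ring

lemma auxX_memLp {m : ℕ} {Ω : Type} [MeasurableSpace Ω] (P : Measure Ω) [IsProbabilityMeasure P]
    (G : (Fin m → NNReal) → Ω → ℝ) (hG : IsCenteredGaussianProcess P G) (s : Fin m → ℝ) :
    MemLp (auxX G s) 2 P := by
  obtain ⟨v, hv⟩ := hG.2 1 (fun _ => auxH s) (fun _ => 1)
  simp only [Finset.univ_unique, Finset.sum_const, Finset.card_singleton, one_smul, one_mul] at hv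
  have h := memLp_id_gaussianReal' (μ := 0) (v := v) 2 (by simp)
  rw [← hv] at h
  have h2 := h.comp_of_map (hG.1 _).aemeasurable
  exact h2.const_mul _

lemma auxX_meas {m : ℕ} {Ω : Type} [MeasurableSpace Ω] (P : Measure Ω)
    (G : (Fin m → NNReal) → Ω → ℝ) (hG : IsCenteredGaussianProcess P G) (s : Fin m → ℝ) :
    Measurable (auxX G s) := (hG.1 _).const_mul _

lemma auxD_meas {m : ℕ} {Ω : Type} [MeasurableSpace Ω] (P : Measure Ω)
    (G : (Fin m → NNReal) → Ω → ℝ) (hG : IsCenteredGaussianProcess P G) (n : ℕ) (N : Fin m → ℕ) :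
    Measurable (auxD G n N) := by
  cases n with
  | zero => exact auxX_meas P G hG _
  | succ n => exact (auxX_meas P G hG _).sub (auxX_meas P G hG _)

lemma auxD_gauss {m : ℕ} {Ω : Type} [MeasurableSpace Ω] (P : Measure Ω)
    (G : (Fin m → NNReal) → Ω → ℝ) (hG : IsCenteredGaussianProcess P G) (n : ℕ) (N : Fin m → ℕ) :
    ∃ v : NNReal, Measure.map (auxD G n N) P = gaussianReal 0 v := by
  cases n with
  | zero =>
    obtain ⟨v, hv⟩ := hG.2 1 (fun _ => auxH (auxp 0 N)) (fun _ => ∏ k, auxp 0 N k)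
    refine ⟨v, ?_⟩
    rw [← hv]
    congr 1
    ext ω
    simp [auxD, auxX]
  | succ n =>
    obtain ⟨v, hv⟩ := hG.2 2
      ![auxH (auxp (n+1) N), auxH (auxp n (fun k => (N k + 1) / 2))]
      ![∏ k, auxp (n+1) N k, -∏ k, auxp n (fun k => (N k + 1) / 2) k]
    refine ⟨v, ?_⟩
    rw [← hv]
    congr 1
    ext ω
    simp [auxD, auxX, Fin.sum_univ_two]
    ring

lemma auxD_var {m : ℕ} (hm : 1 ≤ m) {Ω : Type} [MeasurableSpace Ω] (P : Measure Ω)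
    [IsProbabilityMeasure P]
    (G : (Fin m → NNReal) → Ω → ℝ) (hG : IsCenteredGaussianProcess P G)
    (hcov : ∀ h h' : Fin m → NNReal,
          ∫ ω, G h ω * G h' ω ∂P = ∏ k : Fin m, (((min (h k) (h' k) : NNReal) : ℝ) + 1))
    (n : ℕ) (N : Fin m → ℕ) (hN : ∀ k, 1 ≤ N k ∧ N k ≤ 2 ^ n) :
    ∫ ω, auxD G n N ω * auxD G n N ω ∂P ≤ m / 2 ^ n := by
  have hm' : (1 : ℝ) ≤ m := by exact_mod_cast hm
  cases n with
  | zero =>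
    have hp : ∀ k, auxp 0 N k = 1 := by
      intro k
      have h1 := hN k
      have h2 : N k = 1 := by simp at h1; omega
      simp [auxp, h2]
    simp only [auxD]
    rw [auxX_cov P G hcov _ _ (fun k => by rw [hp]; norm_num) (fun k => le_rfl) (fun k => (hp k).le)]
    simp [hp, hm']
  | succ n =>
    set s : Fin m → ℝ := auxp (n+1) N with hsdef
    set t : Fin m → ℝ := auxp n (fun k => (N k + 1) / 2) with htdef
    have hpn : (0 : ℝ) < 2 ^ n := by positivity
    have hs : ∀ k, 0 < s k := by
      intro k
      have : (0 : ℝ) < N k := by exact_mod_cast (hN k).1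
      simp only [hsdef, auxp]; positivity
    have htk : ∀ k, t k = (2 * ((N k + 1) / 2 : ℕ) : ℕ) / 2 ^ (n + 1) := by
      intro k
      simp only [htdef, auxp]; push_cast; rw [pow_succ]; field_simp
    have hst : ∀ k, s k ≤ t k := by
      intro k
      rw [htk]
      simp only [hsdef, auxp]
      gcongr
      omega
    have htd : ∀ k, t k - s k ≤ 1 / 2 ^ (n + 1) := by
      intro k
      rw [htk]
      simp only [hsdef, auxp]
      rw [← sub_div]
      gcongr
      have : 2 * ((N k + 1) / 2) ≤ N k + 1 := by omega
      have : ((2 * ((N k + 1) / 2) : ℕ) : ℝ) ≤ N k + 1 := by exact_mod_cast this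
      linarith
    have ht : ∀ k, t k ≤ 1 := by
      intro k
      simp only [htdef, auxp]
      rw [div_le_one hpn]
      have h2 := (hN k).2
      rw [pow_succ] at h2
      have : (N k + 1) / 2 ≤ 2 ^ n := by omega
      exact_mod_cast this
    have hss := auxX_cov P G hcov s s hs (fun k => le_rfl) (fun k => (hst k).trans (ht k))
    have htt := auxX_cov P G hcov t t (fun k => (hs k).trans_le (hst k)) (fun k => le_rfl) ht
    have hstc := auxX_cov P G hcov s t hs hst ht
    have hexp : ∀ ω, auxD G (n+1) N ω * auxD G (n+1) N ω =
        (auxX G s ω * auxX G s ω + auxX G t ω * auxX G t ω) - 2 * (auxX G s ω * auxX G t ω) := by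
      intro ω
      simp only [auxD]
      ring
    have iss : Integrable (fun ω => auxX G s ω * auxX G s ω) P := (auxX_memLp P G hG s).integrable_mul (auxX_memLp P G hG s)
    have itt : Integrable (fun ω => auxX G t ω * auxX G t ω) P := (auxX_memLp P G hG t).integrable_mul (auxX_memLp P G hG t)
    have ist : Integrable (fun ω => auxX G s ω * auxX G t ω) P := (auxX_memLp P G hG s).integrable_mul (auxX_memLp P G hG t)
    have : ∫ ω, auxD G (n+1) N ω * auxD G (n+1) N ω ∂P = ∏ k, t k - ∏ k, s k := by
      simp_rw [hexp]
      rw [integral_sub (iss.fun_add itt) (ist.const_mul 2), integral_add iss itt, integral_const_mul,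
        hss, htt, hstc]
      ring
    rw [this]
    have h := aux_prod Finset.univ s t _ (fun k => (hs k).le) hst ht htd
    simp only [Finset.card_univ, Fintype.card_fin] at h
    rw [mul_one_div] at h
    exact h

lemma aux_ceil (x : ℝ) (n : ℕ) :
    (⌈x * 2 ^ (n+1)⌉₊ + 1) / 2 = ⌈x * 2 ^ n⌉₊ := by
  apply eq_of_forall_ge_iff
  intro c
  rw [Nat.ceil_le]
  have h1 : (⌈x * 2 ^ (n+1)⌉₊ + 1) / 2 ≤ c ↔ ⌈x * 2 ^ (n+1)⌉₊ ≤ 2 * c := by omega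
  rw [h1, Nat.ceil_le, pow_succ]
  push_cast
  constructor <;> intro h <;> linarith

lemma aux_incl {m : ℕ} {Ω : Type}
    (G : (Fin m → NNReal) → Ω → ℝ) (ω : Ω)
    (hc : Continuous (fun h : Fin m → NNReal => G h ω)) (u : ℝ) (hu : 0 ≤ u)
    (hB : ∀ n : ℕ, ∀ N : Fin m → ℕ, (∀ k, 1 ≤ N k ∧ N k ≤ 2 ^ n) →
      |auxD G n N ω| ≤ u / 4 * (3 / 4) ^ n) (h : Fin m → NNReal) :
    |G h ω| / ∏ k : Fin m, ((h k : ℝ) + 1) ≤ u := by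
  set s : Fin m → ℝ := fun k => ((h k : ℝ) + 1)⁻¹ with hs
  have hh : ∀ k, (0 : ℝ) ≤ h k := fun k => (h k).2
  have hs0 : ∀ k, 0 < s k := fun k => by have := hh k; simp only [hs]; positivity
  have hs1 : ∀ k, s k ≤ 1 := fun k => inv_le_one_of_one_le₀ (by have := hh k; linarith)
  let N : ℕ → Fin m → ℕ := fun n k => ⌈s k * 2 ^ n⌉₊
  have hN : ∀ n k, 1 ≤ N n k ∧ N n k ≤ 2 ^ n := by
    intro n k
    have h2 : (0 : ℝ) < 2 ^ n := by positivity
    refine ⟨Nat.ceil_pos.2 (mul_pos (hs0 k) h2), Nat.ceil_le.2 ?_⟩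
    push_cast
    nlinarith [hs1 k]
  have hstep : ∀ n, |auxX G (auxp n (N n)) ω| ≤ u * (1 - (3 / 4) ^ (n + 1)) := by
    intro n
    induction n with
    | zero =>
      have := hB 0 (N 0) (hN 0)
      simp only [auxD] at this
      norm_num at this ⊢
      linarith
    | succ n ih =>
      have h1 := hB (n+1) (N (n+1)) (hN (n+1))
      have h2 : (fun k => (N (n+1) k + 1) / 2) = N n := by
        ext k; exact aux_ceil _ _
      simp only [auxD, h2] at h1
      have h3 := abs_sub_abs_le_abs_sub (auxX G (auxp (n+1) (N (n+1))) ω) (auxX G (auxp n (N n)) ω)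
      rw [pow_succ (3/4 : ℝ) (n+1)]
      nlinarith
  have hlim : Filter.Tendsto (fun n => auxp n (N n)) Filter.atTop (nhds s) := by
    rw [tendsto_pi_nhds]
    intro k
    exact (tendsto_nat_ceil_mul_div_atTop (hs0 k).le).comp
      (tendsto_pow_atTop_atTop_of_one_lt (by norm_num : (1:ℝ) < 2))
  have hlimH : Filter.Tendsto (fun n => auxH (auxp n (N n))) Filter.atTop (nhds (auxH s)) := by
    rw [tendsto_pi_nhds]
    intro k
    have hk := (tendsto_pi_nhds.1 hlim) k
    exact (continuous_real_toNNReal.tendsto _).comp ((hk.inv₀ (hs0 k).ne').sub_const 1)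
  have hlimX : Filter.Tendsto (fun n => auxX G (auxp n (N n)) ω) Filter.atTop
      (nhds (auxX G s ω)) := by
    refine Filter.Tendsto.mul ?_ ((hc.tendsto _).comp hlimH)
    exact tendsto_finsetProd _ fun k _ => (tendsto_pi_nhds.1 hlim) k
  have hfin : |auxX G s ω| ≤ u := by
    refine le_of_tendsto hlimX.abs (Filter.Eventually.of_forall fun n => (hstep n).trans ?_)
    have : (0:ℝ) ≤ (3/4) ^ (n+1) := by positivity
    nlinarith
  have hHs : auxH s = h := by
    ext k
    simp [auxH, hs]
  have hpos : 0 < ∏ k, s k := Finset.prod_pos fun k _ => hs0 k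
  unfold auxX at hfin
  rw [hHs, abs_mul, abs_of_pos hpos] at hfin
  rw [div_eq_mul_inv, ← Finset.prod_inv_distrib, mul_comm]
  exact hfin

lemma aux_summable (m : ℕ) (hm : 1 ≤ m) :
    Summable fun n : ℕ => (2 : ℝ) ^ (n * m) * (2 * Real.exp (-((9 / 8) ^ n / (64 * m)))) := by
  have hm' : (0 : ℝ) < m := by exact_mod_cast hm
  set K : ℝ := 2 * ((12 * m).factorial * (64 * m) ^ (12 * m)) with hK
  refine Summable.of_nonneg_of_le (fun n => by positivity) (fun n => ?_)
    ((summable_geometric_of_lt_one (r := (1/2 : ℝ)) (by norm_num) (by norm_num)).mul_left K)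
  set y : ℝ := (9 / 8) ^ n / (64 * m) with hy
  have hy0 : 0 < y := by positivity
  have h1 := Real.pow_div_factorial_le_exp y hy0.le (12 * m)
  have h2 : Real.exp (-y) ≤ (12 * m).factorial / y ^ (12 * m) := by
    rw [Real.exp_neg, ← inv_div]
    exact inv_anti₀ (by positivity) h1
  have h3 : ((12 * m).factorial : ℝ) / y ^ (12 * m)
      = ((12 * m).factorial * (64 * m) ^ (12 * m)) * (((8/9) ^ 12) ^ (n * m)) := by
    rw [hy, div_pow, ← pow_mul, ← pow_mul]
    have : (8/9 : ℝ) = (9/8)⁻¹ := by norm_num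
    rw [this, inv_pow, show 12 * (n * m) = n * (12 * m) by ring]
    field_simp
  have h4 : (2 : ℝ) ^ (n * m) * ((8/9) ^ 12) ^ (n * m) ≤ (1/2) ^ n := by
    rw [← mul_pow]
    calc ((2 : ℝ) * (8/9) ^ 12) ^ (n * m) ≤ (1/2) ^ (n * m) := by
          apply pow_le_pow_left₀ (by positivity); norm_num
      _ ≤ (1/2) ^ n := pow_le_pow_of_le_one (by norm_num) (by norm_num) (Nat.le_mul_of_pos_right n hm)
  calc (2 : ℝ) ^ (n * m) * (2 * Real.exp (-y))
      ≤ (2 : ℝ) ^ (n * m) * (2 * (((12 * m).factorial * (64 * m) ^ (12 * m)) * (((8/9) ^ 12) ^ (n * m)))) := by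
        rw [h3] at h2; gcongr
    _ = K * ((2 : ℝ) ^ (n * m) * ((8/9) ^ 12) ^ (n * m)) := by rw [hK]; ring
    _ ≤ _ := by gcongr

/-- Lemma 5 of the paper: for the centered Gaussian process on `ℝ_{≥0}^m` with covariance
`∏_k (h_k ∧ h'_k + 1)` and continuous paths, there is a constant `C_m > 0` depending only
on `m` such that `P(sup_h |G(h)|/∏_k(h_k+1) > u) ≤ C_m·exp(−u²/C_m)` for every `u ≥ 1`. -/
theorem stmt15 (m : ℕ) (hm : 1 ≤ m) :
    ∃ C : ℝ, 0 < C ∧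
      ∀ (Ω : Type) [MeasurableSpace Ω] (P : Measure Ω) [IsProbabilityMeasure P]
        (G : (Fin m → NNReal) → Ω → ℝ),
        IsCenteredGaussianProcess P G →
        (∀ h h' : Fin m → NNReal,
          ∫ ω, G h ω * G h' ω ∂P = ∏ k : Fin m, (((min (h k) (h' k) : NNReal) : ℝ) + 1)) →
        (∀ ω : Ω, Continuous (fun h : Fin m → NNReal => G h ω)) →
        ∀ u : ℝ, 1 ≤ u →
          P {ω : Ω |
            u < sSup {y : ℝ | ∃ h : Fin m → NNReal,
              y = |G h ω| / ∏ k : Fin m, ((h k : ℝ) + 1)}} ≤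
            ENNReal.ofReal (C * Real.exp (-u ^ 2 / C)) := by
  have hm' : (1 : ℝ) ≤ m := by exact_mod_cast hm
  set f : ℕ → ℝ := fun n => (2 : ℝ) ^ (n * m) * (2 * Real.exp (-((9 / 8) ^ n / (64 * m)))) with hf
  have hsum : Summable f := aux_summable m hm
  have hf0 : ∀ n, 0 ≤ f n := fun n => by simp only [hf]; positivity
  set K := ∑' n, f n with hKdef
  have hK : 0 ≤ K := tsum_nonneg hf0
  refine ⟨K + 64 * m, by positivity, ?_⟩
  intro Ω _ P _ G hG hcov hcont u hu
  let S : ℕ → Finset (Fin m → ℕ) := fun n => Fintype.piFinset fun _ => Finset.Icc 1 (2 ^ n)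
  have hS : ∀ n N, N ∈ S n ↔ ∀ k, 1 ≤ N k ∧ N k ≤ 2 ^ n := by
    intro n N; simp [S, Fintype.mem_piFinset]
  have hcard : ∀ n, (S n).card = 2 ^ (n * m) := by
    intro n; simp [S, Fintype.card_piFinset, pow_mul]
  have hsub : {ω : Ω | u < sSup {y : ℝ | ∃ h : Fin m → NNReal,
              y = |G h ω| / ∏ k : Fin m, ((h k : ℝ) + 1)}} ⊆
      ⋃ n, ⋃ N ∈ S n, {ω | u / 4 * (3 / 4) ^ n < |auxD G n N ω|} := by
    intro ω hω
    by_contra hcon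
    simp only [Set.mem_iUnion, not_exists, Set.mem_ofPred_eq, not_lt] at hcon
    have := aux_incl G ω (hcont ω) u (by linarith) (fun n N hN => hcon n N ((hS n N).2 hN))
    refine absurd hω (not_lt.2 (Real.sSup_le ?_ (by linarith)))
    rintro y ⟨h, rfl⟩
    exact this h
  have hlev : ∀ n, P (⋃ N ∈ S n, {ω | u / 4 * (3 / 4) ^ n < |auxD G n N ω|}) ≤
      ENNReal.ofReal (f n * Real.exp (-u ^ 2 / (64 * m))) := by
    intro n
    have hb : ∀ N ∈ S n, P {ω | u / 4 * (3 / 4) ^ n < |auxD G n N ω|} ≤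
        ENNReal.ofReal (2 * Real.exp (-((9 / 8) ^ n / (64 * m))) * Real.exp (-u ^ 2 / (64 * m))) := by
      intro N hN
      obtain ⟨v, hv⟩ := auxD_gauss P G hG n N
      refine (aux_tail P _ (auxD_meas P G hG n N) v hv _
        (auxD_var hm P G hG hcov n N ((hS n N).1 hN)) _ (by positivity)).trans ?_
      apply ENNReal.ofReal_le_ofReal
      rw [mul_assoc, ← Real.exp_add]
      gcongr
      have e1 : -(u / 4 * (3 / 4) ^ n) ^ 2 / (2 * (m / 2 ^ n)) = -(2 * (u ^ 2 * (9 / 8) ^ n)) / (64 * m) := by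
        have : (9/8 : ℝ) ^ n = ((3/4) ^ n) ^ 2 * 2 ^ n := by
          rw [← pow_mul, mul_comm n 2, pow_mul, ← mul_pow]; norm_num
        rw [this]
        field_simp
        ring
      rw [e1, ← neg_div, ← add_div]
      gcongr
      have hq : (1 : ℝ) ≤ (9/8) ^ n := one_le_pow₀ (by norm_num)
      have hu2 : 1 ≤ u ^ 2 := one_le_pow₀ hu
      nlinarith
    calc _ ≤ ∑ N ∈ S n, P {ω | u / 4 * (3 / 4) ^ n < |auxD G n N ω|} := measure_biUnion_finset_le _ _
      _ ≤ ∑ N ∈ S n, _ := Finset.sum_le_sum hb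
      _ = _ := by
        rw [Finset.sum_const, hcard, ← ENNReal.ofReal_nsmul]
        congr 1
        simp [hf]
        ring
  calc _ ≤ _ := measure_mono hsub
    _ ≤ _ := measure_iUnion_le _
    _ ≤ ∑' n, ENNReal.ofReal (f n * Real.exp (-u ^ 2 / (64 * m))) := ENNReal.tsum_le_tsum hlev
    _ = ENNReal.ofReal (K * Real.exp (-u ^ 2 / (64 * m))) := by
      rw [← ENNReal.ofReal_tsum_of_nonneg (fun n => mul_nonneg (hf0 n) (Real.exp_pos _).le)
        (hsum.mul_right _), tsum_mul_right]
    _ ≤ _ := by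
      apply ENNReal.ofReal_le_ofReal
      have h1 : -u ^ 2 / (64 * m) ≤ -u ^ 2 / (K + 64 * m) := by
        rw [neg_div, neg_div]
        apply neg_le_neg
        apply div_le_div_of_nonneg_left (by positivity) (by positivity) (by linarith)
      have h2 : K ≤ K + 64 * m := by linarith
      gcongr
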